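/- (Comparison principle) Let n ≥ 1, Λ ≥ 1, R > 0, T > 0, and let F be uniformly elliptic with constant Λ. Let u and v be continuous on the closed cylinder B̄_R×[0,T], with u a viscosity subsolution and v a viscosity supersolution of w_t = F(D²w) in B_R×(0,T). If u ≤ v on (B̄_R×{0}) ∪ (∂B_R×[0,T]), then u ≤ v in B_R×(0,T). -/

import Mathlib

open Set MeasureTheory Metric
open scoped RealInnerProductSpace

noncomputable section

abbrev Eucl (n : ℕ) : Type := EuclideanSpace ℝ (Fin n)
abbrev SpaceTime (n : ℕ) : Type := Eucl n × ℝ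

/-- The operator norm of an `n × n` real matrix, acting on Euclidean space. -/
noncomputable def matOpNorm {n : ℕ} (A : Matrix (Fin n) (Fin n) ℝ) : ℝ :=
  ‖(LinearMap.toContinuousLinearMap (Matrix.toEuclideanLin A))‖

/-- `F` is uniformly elliptic with ellipticity constant `Λ`. -/
def UniformlyElliptic {n : ℕ} (Λ : ℝ) (F : Matrix (Fin n) (Fin n) ℝ → ℝ) : Prop :=
  ∀ M N : Matrix (Fin n) (Fin n) ℝ, M.IsSymm → N.IsSymm → N.PosSemidef →
    Λ⁻¹ * matOpNorm N ≤ F (M + N) - F M ∧ F (M + N) - F M ≤ Λ * matOpNorm N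

/-- Pucci minimal operator `P⁻(R, a, b) = a ∑_{eᵢ>0} eᵢ + b ∑_{eᵢ<0} eᵢ`. -/
noncomputable def pucciMinus {n : ℕ} (R : Matrix (Fin n) (Fin n) ℝ) (a b : ℝ) : ℝ :=
  if h : R.IsHermitian then
    a * ∑ i, max (h.eigenvalues i) 0 + b * ∑ i, min (h.eigenvalues i) 0
  else 0

/-- Pucci maximal operator `P⁺(R, a, b) = a ∑_{eᵢ<0} eᵢ + b ∑_{eᵢ>0} eᵢ`. -/
noncomputable def pucciPlus {n : ℕ} (R : Matrix (Fin n) (Fin n) ℝ) (a b : ℝ) : ℝ :=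
  if h : R.IsHermitian then
    a * ∑ i, min (h.eigenvalues i) 0 + b * ∑ i, max (h.eigenvalues i) 0
  else 0

/-- Parabolic cylinder `E_ρ(x₀,t₀) = B_ρ(x₀) × (t₀ − ρ², t₀]`. -/
def cylE {n : ℕ} (x₀ : Eucl n) (t₀ ρ : ℝ) : Set (SpaceTime n) :=
  (ball x₀ ρ) ×ˢ (Ioc (t₀ - ρ ^ 2) t₀)

/-- `φ` is C² in `x` and C¹ in `t` on `D`, with time derivative `φt`,
spatial gradient `gφ` and spatial Hessian `Hφ`. -/
structure ParabolicTest {n : ℕ} (φ : SpaceTime n → ℝ) (D : Set (SpaceTime n))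
    (φt : SpaceTime n → ℝ) (gφ : SpaceTime n → Eucl n)
    (Hφ : SpaceTime n → Matrix (Fin n) (Fin n) ℝ) : Prop where
  contPhi : ContinuousOn φ D
  contPhit : ContinuousOn φt D
  contGrad : ContinuousOn gφ D
  contHess : ContinuousOn Hφ D
  symmHess : ∀ p ∈ D, (Hφ p).IsSymm
  timeDeriv : ∀ p ∈ D, HasDerivWithinAt (fun s : ℝ => φ (p.1, s)) (φt p) {s : ℝ | (p.1, s) ∈ D} p.2
  spaceGrad : ∀ p ∈ D, HasGradientWithinAt (fun y => φ (y, p.2)) (gφ p) {y | (y, p.2) ∈ D} p.1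
  spaceHess : ∀ p ∈ D, HasFDerivWithinAt (fun y => gφ (y, p.2))
      (LinearMap.toContinuousLinearMap (Matrix.toEuclideanLin (Hφ p))) {y | (y, p.2) ∈ D} p.1

/-- `φ` touches `u` from above at `p₀` in the set `E`. -/
def TouchesAbove {n : ℕ} (φ u : SpaceTime n → ℝ) (E : Set (SpaceTime n)) (p₀ : SpaceTime n) :
    Prop :=
  p₀ ∈ E ∧ φ p₀ = u p₀ ∧ ∀ p ∈ E, u p ≤ φ p

/-- `φ` touches `u` from below at `p₀` in the set `E`. -/
def TouchesBelow {n : ℕ} (φ u : SpaceTime n → ℝ) (E : Set (SpaceTime n)) (p₀ : SpaceTime n) :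
    Prop :=
  p₀ ∈ E ∧ φ p₀ = u p₀ ∧ ∀ p ∈ E, φ p ≤ u p

/-- `u` is a viscosity subsolution of `u_t = F(D²u)` in `D`. -/
def ViscSub {n : ℕ} (F : Matrix (Fin n) (Fin n) ℝ → ℝ) (u : SpaceTime n → ℝ)
    (D : Set (SpaceTime n)) : Prop :=
  ∀ (φ φt : SpaceTime n → ℝ) (gφ : SpaceTime n → Eucl n)
    (Hφ : SpaceTime n → Matrix (Fin n) (Fin n) ℝ) (p₀ : SpaceTime n) (ρ : ℝ),
    0 < ρ → p₀ ∈ D → cylE p₀.1 p₀.2 ρ ⊆ D →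
    ParabolicTest φ (cylE p₀.1 p₀.2 ρ) φt gφ Hφ →
    TouchesAbove φ u (cylE p₀.1 p₀.2 ρ) p₀ →
    φt p₀ ≤ F (Hφ p₀)

/-- `u` is a viscosity supersolution of `u_t = F(D²u)` in `D`. -/
def ViscSup {n : ℕ} (F : Matrix (Fin n) (Fin n) ℝ → ℝ) (u : SpaceTime n → ℝ)
    (D : Set (SpaceTime n)) : Prop :=
  ∀ (φ φt : SpaceTime n → ℝ) (gφ : SpaceTime n → Eucl n)
    (Hφ : SpaceTime n → Matrix (Fin n) (Fin n) ℝ) (p₀ : SpaceTime n) (ρ : ℝ),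
    0 < ρ → p₀ ∈ D → cylE p₀.1 p₀.2 ρ ⊆ D →
    ParabolicTest φ (cylE p₀.1 p₀.2 ρ) φt gφ Hφ →
    TouchesBelow φ u (cylE p₀.1 p₀.2 ρ) p₀ →
    F (Hφ p₀) ≤ φt p₀

end


section abstractJ
variable {E : Type*} [NormedAddCommGroup E] [InnerProductSpace ℝ E]

def Sand (f : E → ℝ) (C : ℝ) (z q : E) : Prop :=
  ∀ y, |f y - f z - inner ℝ q (y - z)| ≤ C * ‖y - z‖ ^ 2

lemma lin_zero (a : E) (K : ℝ) (h : ∀ y, inner ℝ a y ≤ K * ‖y‖ ^ 2) : a = 0 := by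
  by_contra ha
  have hpos : 0 < ‖a‖ := norm_pos_iff.2 ha
  have ht : 0 < 1 / (|K| + 1) := by positivity
  have h1 := h ((1 / (|K| + 1)) • a)
  rw [inner_smul_right, real_inner_self_eq_norm_sq, norm_smul, Real.norm_of_nonneg ht.le] at h1
  have h2 : K * (1 / (|K| + 1)) < 1 := by
    rw [mul_one_div, div_lt_one (by positivity)]
    linarith [le_abs_self K]
  have h3 : 0 < 1 / (|K| + 1) * ‖a‖ ^ 2 := by positivity
  have h4 : K * (1 / (|K| + 1)) * (1 / (|K| + 1) * ‖a‖ ^ 2) < 1 * (1 / (|K| + 1) * ‖a‖ ^ 2) :=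
    mul_lt_mul_of_pos_right h2 h3
  nlinarith

lemma sand_lip {f : E → ℝ} {C : ℝ} {z1 z2 q1 q2 : E} (hC : 0 ≤ C)
    (h1 : Sand f C z1 q1) (h2 : Sand f C z2 q2) : ‖q1 - q2‖ ≤ 6 * C * ‖z1 - z2‖ := by
  by_cases hz : z1 = z2
  · subst hz
    have : q1 - q2 = 0 := by
      apply lin_zero _ (2 * C)
      intro y
      have a1 := abs_le.1 (h1 (z1 + y))
      have a2 := abs_le.1 (h2 (z1 + y))
      simp only [add_sub_cancel_left] at a1 a2
      rw [inner_sub_left]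
      linarith [a1.1, a2.2, a1.2, a2.1]
    simp [this]
  by_cases hq : q1 = q2
  · subst hq; simp; positivity
  have hd : 0 < ‖z1 - z2‖ := norm_pos_iff.2 (sub_ne_zero.2 hz)
  have hw : 0 < ‖q1 - q2‖ := norm_pos_iff.2 (sub_ne_zero.2 hq)
  set d := ‖z1 - z2‖ with hd'
  set e : E := (d / ‖q1 - q2‖) • (q1 - q2) with he
  have hen : ‖e‖ = d := by
    rw [he, norm_smul, Real.norm_of_nonneg (by positivity)]
    field_simp
  have hin : inner ℝ (q1 - q2) e = d * ‖q1 - q2‖ := by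
    rw [he, inner_smul_right, real_inner_self_eq_norm_sq]
    field_simp
  have a1 := abs_le.1 (h1 (z1 + e))
  have a2 := abs_le.1 (h2 (z1 + e))
  have a3 := abs_le.1 (h2 z1)
  have e1 : z1 + e - z2 = (z1 - z2) + e := by abel
  rw [add_sub_cancel_left, hen] at a1
  rw [e1, inner_add_right] at a2
  rw [← hd'] at a3
  have n1 : ‖(z1 - z2) + e‖ ≤ 2 * d := by
    calc _ ≤ ‖z1 - z2‖ + ‖e‖ := norm_add_le _ _
      _ = 2 * d := by rw [hen, ← hd']; ring
  have n2 : C * ‖(z1 - z2) + e‖ ^ 2 ≤ C * (4 * d ^ 2) := by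
    apply mul_le_mul_of_nonneg_left _ hC
    nlinarith [norm_nonneg ((z1 - z2) + e)]
  rw [inner_sub_left] at hin
  have : d * ‖q1 - q2‖ ≤ d * (6 * C * d) := by nlinarith [a1.1, a1.2, a2.1, a2.2, a3.1, a3.2]
  exact le_of_mul_le_mul_left this hd

lemma envelope [FiniteDimensional ℝ E] (W : E → ℝ) (D : ℝ) (hD : 0 ≤ D)
    (hW : ∀ z, ∃ q, ∀ y, W y ≤ W z + inner ℝ q (y - z) + D * ‖y - z‖ ^ 2)
    (hmin : ∃ c q, ∀ y, c + inner ℝ q y ≤ W y) :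
    ∃ (e : E → ℝ) (G : E → E), (∀ z, Sand e (2 * D) z (G z)) ∧ (∀ z, e z ≤ W z) ∧
      (∀ z a q, (∀ y, a + inner ℝ q (y - z) ≤ W y) → a ≤ e z) := by
  have key : ∀ z, ∃ (a : ℝ) (q : E), (∀ y, a + inner ℝ q (y - z) ≤ W y) ∧
      ∀ a' q', (∀ y, a' + inner ℝ q' (y - z) ≤ W y) → a' ≤ a := by
    intro z
    obtain ⟨c, q0, h0⟩ := hmin
    obtain ⟨q1, h1⟩ := hW z
    set S : Set (ℝ × E) := {s | c + inner ℝ q0 z ≤ s.1 ∧ ∀ y, s.1 + inner ℝ s.2 (y - z) ≤ W y}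
      with hS
    have hclosed : IsClosed S := by
      rw [hS, ofPred_and, ofPred_forall]
      refine IsClosed.inter (isClosed_le continuous_const continuous_fst) ?_
      refine isClosed_iInter fun y => isClosed_le (by fun_prop) continuous_const
    have hbdd : S ⊆ Icc (c + inner ℝ q0 z) (W z) ×ˢ
        closedBall q1 (W z - (c + inner ℝ q0 z) + D) := by
      rintro ⟨a, q⟩ ⟨ha, hq⟩
      simp only at ha hq
      have haz : a ≤ W z := by simpa using hq z
      refine ⟨⟨ha, haz⟩, ?_⟩
      simp only [mem_closedBall, dist_eq_norm]
      by_cases hqq : q = q1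
      · subst hqq
        have hn : 0 ≤ W z - (c + inner ℝ q0 z) + D := by linarith
        simpa using hn
      · have hy' : 0 < ‖q - q1‖ := norm_pos_iff.2 (sub_ne_zero.2 hqq)
        have b1 := h1 (z + (1 / ‖q - q1‖) • (q - q1))
        have b2 := hq (z + (1 / ‖q - q1‖) • (q - q1))
        simp only [add_sub_cancel_left] at b1 b2
        have b3 : inner ℝ (q - q1) ((1 / ‖q - q1‖) • (q - q1)) = ‖q - q1‖ := by
          rw [inner_smul_right, real_inner_self_eq_norm_sq]; field_simp
        rw [norm_smul, norm_div, norm_one, norm_norm, one_div_mul_cancel hy'.ne'] at b1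
        rw [inner_sub_left] at b3
        linarith
    have hcomp : IsCompact S :=
      (isCompact_Icc.prod (isCompact_closedBall _ _)).of_isClosed_subset hclosed hbdd
    have hne : S.Nonempty := by
      refine ⟨(c + inner ℝ q0 z, q0), le_rfl, fun y => ?_⟩
      have := h0 y
      simp only [inner_sub_right]; linarith
    obtain ⟨⟨a, q⟩, ⟨ha, hq⟩, hmaxs⟩ := hcomp.exists_isMaxOn hne continuous_fst.continuousOn
    refine ⟨a, q, hq, fun a' q' h' => ?_⟩
    by_cases hc : c + inner ℝ q0 z ≤ a'
    · exact hmaxs (show (a', q') ∈ S from ⟨hc, h'⟩)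
    · simp only at ha; linarith
  choose e G hG1 hG2 using key
  have hconv : ∀ z y, e z + inner ℝ (G z) (y - z) ≤ e y := by
    intro z y
    apply hG2 y _ (G z)
    intro x
    have := hG1 z x
    simp only [inner_sub_right] at *
    linarith
  have hsc : ∀ z y, e (z + y) + e (z - y) ≤ 2 * e z + 2 * D * ‖y‖ ^ 2 := by
    intro z y
    have : (e (z + y) + e (z - y)) / 2 - D * ‖y‖ ^ 2 ≤ e z := by
      apply hG2 z _ ((1 / 2 : ℝ) • (G (z + y) + G (z - y)))
      intro x
      have a1 := hG1 (z + y) (x + y)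
      have a2 := hG1 (z - y) (x - y)
      obtain ⟨q, hq⟩ := hW x
      have a3 := hq (x + y)
      have a4 := hq (x - y)
      have e1 : x + y - (z + y) = x - z := by abel
      have e2 : x - y - (z - y) = x - z := by abel
      have e3 : x - y - x = - y := by abel
      rw [e1] at a1; rw [e2] at a2
      rw [e3, inner_neg_right, norm_neg] at a4
      rw [add_sub_cancel_left] at a3
      rw [inner_smul_left, inner_add_left]
      simp only [one_div, map_inv₀, conj_trivial]
      linarith
    linarith
  refine ⟨e, G, fun z y => ?_, fun z => by simpa using hG1 z z, hG2⟩
  have a1 := hconv z y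
  have a2 := hsc z (y - z)
  have a3 := hconv z (z - (y - z))
  have e1 : z + (y - z) = y := by abel
  have e2 : z - (y - z) - z = -(y - z) := by abel
  rw [e1] at a2
  rw [e2, inner_neg_right] at a3
  have : 0 ≤ 2 * D * ‖y - z‖ ^ 2 := by positivity
  rw [abs_le]
  constructor <;> linarith

lemma sand_hasFDeriv {f : E → ℝ} {C : ℝ} {z q : E} (h : Sand f C z q) :
    HasFDerivAt f (innerSL ℝ q) z := by
  rw [hasFDerivAt_iff_isLittleO]
  have h1 : (fun y => f y - f z - (innerSL ℝ q) (y - z)) =O[nhds z] (fun y => ‖y - z‖ ^ 2) := by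
    refine Asymptotics.IsBigO.of_bound C (Filter.Eventually.of_forall fun y => ?_)
    simpa using h y
  refine h1.trans_isLittleO ?_
  have h2 : (fun y : E => ‖y - z‖ ^ 2) =o[nhds z] (fun y => ‖y - z‖) := by
    have h3 : (fun y : E => ‖y - z‖) =o[nhds z] (fun _ => (1 : ℝ)) := by
      rw [Asymptotics.isLittleO_one_iff]
      have : Continuous fun y : E => ‖y - z‖ := by fun_prop
      simpa using this.tendsto z
    have := h3.mul_isBigO (Asymptotics.isBigO_refl (fun y : E => ‖y - z‖) (nhds z))
    simpa [sq] using this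
  exact h2.norm_right.congr_right (by simp) |>.of_norm_right

lemma taylor2 {g : E → ℝ} {C : ℝ} {G : E → E} (h : ∀ z, Sand g C z (G z)) {z : E}
    {L : E →L[ℝ] E} (hL : HasFDerivAt G L z) {η : ℝ} (hη : 0 < η) :
    ∃ δ > 0, ∀ y, ‖y‖ < δ →
      |g (z + y) - g z - inner ℝ (G z) y - 1 / 2 * inner ℝ (L y) y| ≤ η * ‖y‖ ^ 2 := by
  have h1 := (hasFDerivAt_iff_isLittleO.1 hL).def hη
  rw [Metric.eventually_nhds_iff] at h1
  obtain ⟨δ, hδ, h1⟩ := h1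
  refine ⟨δ, hδ, fun y hy => ?_⟩
  set φ : ℝ → ℝ := fun s => g (z + s • y) - s * inner ℝ (G z) y - s ^ 2 / 2 * inner ℝ (L y) y
    with hφ
  have hd : ∀ s ∈ Icc (0 : ℝ) 1, HasDerivWithinAt φ
      (inner ℝ (G (z + s • y)) y - inner ℝ (G z) y - s * inner ℝ (L y) y) (Icc 0 1) s := by
    intro s _
    apply HasDerivAt.hasDerivWithinAt
    have a1 : HasDerivAt (fun s : ℝ => z + s • y) y s := by
      simpa using ((hasDerivAt_id s).smul_const y).const_add z
    have a2 : HasDerivAt (fun s : ℝ => g (z + s • y)) (inner ℝ (G (z + s • y)) y) s :=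
      HasFDerivAt.comp_hasDerivAt (l := g) s (sand_hasFDeriv (h (z + s • y))) a1
    have a3 : HasDerivAt (fun s : ℝ => s * inner ℝ (G z) y) (inner ℝ (G z) y) s := by
      simpa using (hasDerivAt_id s).mul_const (inner ℝ (G z) y)
    have a4 : HasDerivAt (fun s : ℝ => s ^ 2 / 2 * inner ℝ (L y) y) (s * inner ℝ (L y) y) s := by
      have := (((hasDerivAt_id s).pow 2).div_const 2).mul_const (inner ℝ (L y) y)
      refine this.congr_deriv ?_
      simp
    exact (a2.sub a3).sub a4
  have hb : ∀ s ∈ Ico (0 : ℝ) 1,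
      ‖inner ℝ (G (z + s • y)) y - inner ℝ (G z) y - s * inner ℝ (L y) y‖ ≤ η * ‖y‖ ^ 2 := by
    intro s hs
    have hsy : ‖s • y‖ ≤ ‖y‖ := by
      rw [norm_smul, Real.norm_of_nonneg hs.1]
      nlinarith [norm_nonneg y, hs.2]
    have b1 := h1 (y := z + s • y) (by rw [dist_eq_norm, add_sub_cancel_left]; linarith)
    rw [add_sub_cancel_left, map_smul] at b1
    have b2 : inner ℝ (G (z + s • y)) y - inner ℝ (G z) y - s * inner ℝ (L y) y
        = inner ℝ (G (z + s • y) - G z - s • L y) y := by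
      rw [inner_sub_left, inner_sub_left, inner_smul_left]; simp
    rw [b2]
    calc _ ≤ ‖G (z + s • y) - G z - s • L y‖ * ‖y‖ := norm_inner_le_norm _ _
      _ ≤ (η * ‖y‖) * ‖y‖ := by
        gcongr
        exact b1.trans (by gcongr)
      _ = _ := by ring
  have := norm_image_sub_le_of_norm_deriv_le_segment' hd hb 1 (by simp)
  have e1 : φ 1 - φ 0 = g (z + y) - g z - inner ℝ (G z) y - 1 / 2 * inner ℝ (L y) y := by
    simp only [hφ]; simp; ring
  rw [e1] at this
  simpa using this

theorem jensen [FiniteDimensional ℝ E] [MeasurableSpace E] [BorelSpace E] (U V : E → ℝ)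
    (C r : ℝ) (hC : 0 ≤ C) (hr : 0 < r)
    (hU : ∀ z, ∃ q, ∀ y, U z + inner ℝ q (y - z) - C * ‖y - z‖ ^ 2 ≤ U y)
    (hV : ∀ z, ∃ q, ∀ y, V y ≤ V z + inner ℝ q (y - z) + C * ‖y - z‖ ^ 2)
    (hmax : ∀ p, ‖p‖ < r → ∃ z, ∀ y, U y - V y - inner ℝ p y ≤ U z - V z - inner ℝ p z) :
    ∃ (p z q : E) (L : E →L[ℝ] E), ‖p‖ < r ∧
      (∀ y, U y - V y - inner ℝ p y ≤ U z - V z - inner ℝ p z) ∧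
      ∀ η > 0, ∃ δ > 0, ∀ y, ‖y‖ < δ →
        V z + inner ℝ q y + 1 / 2 * inner ℝ (L y) y - η * ‖y‖ ^ 2 ≤ V (z + y) ∧
        U (z + y) ≤ U z + inner ℝ (q + p) y + 1 / 2 * inner ℝ (L y) y + η * ‖y‖ ^ 2 := by
  have sqexp : ∀ y z : E, ‖y‖ ^ 2 = ‖z‖ ^ 2 + 2 * inner ℝ z (y - z) + ‖y - z‖ ^ 2 := by
    intro y z
    have := norm_add_sq_real z (y - z)
    rwa [add_sub_cancel] at this
  set W : E → ℝ := fun y => V y + C * ‖y‖ ^ 2 with hWdef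
  have hW : ∀ z, ∃ q, ∀ y, W y ≤ W z + inner ℝ q (y - z) + (2 * C) * ‖y - z‖ ^ 2 := by
    intro z
    obtain ⟨q, hq⟩ := hV z
    refine ⟨q + (2 * C) • z, fun y => ?_⟩
    have := hq y
    simp only [hWdef]
    rw [inner_add_left, inner_smul_left, sqexp y z]
    simp only [conj_trivial]
    nlinarith
  have hcontact : ∀ p z, (∀ y, U y - V y - inner ℝ p y ≤ U z - V z - inner ℝ p z) →
      ∀ x, ∃ q, ∀ y, (U x - inner ℝ p x - (U z - V z - inner ℝ p z) + C * ‖x‖ ^ 2)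
        + inner ℝ q (y - x) ≤ W y := by
    intro p z h x
    obtain ⟨q, hq⟩ := hU x
    refine ⟨q - p + (2 * C) • x, fun y => ?_⟩
    have b1 := hq y
    have b2 := h y
    simp only [hWdef]
    rw [inner_add_left, inner_smul_left, sqexp y x, inner_sub_left, inner_sub_right p]
    simp only [conj_trivial]
    nlinarith
  have hmin : ∃ c q, ∀ y, c + inner ℝ q y ≤ W y := by
    obtain ⟨z, hz⟩ := hmax 0 (by simpa using hr)
    obtain ⟨q, hq⟩ := hcontact 0 z hz z
    refine ⟨V z + C * ‖z‖ ^ 2 - inner ℝ q z, q, fun y => ?_⟩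
    have := hq y
    rw [inner_sub_right q] at this
    refine le_trans (le_of_eq ?_) this
    ring
  obtain ⟨e, H, hS, hle, heq⟩ := envelope W (2 * C) (by positivity) hW hmin
  set g : E → ℝ := fun y => e y - C * ‖y‖ ^ 2 with hg
  set G : E → E := fun y => H y - (2 * C) • y with hGdef
  have hgS : ∀ z, Sand g (5 * C) z (G z) := by
    intro z y
    have b := abs_le.1 (hS z y)
    have c : 0 ≤ C * ‖y - z‖ ^ 2 := by positivity
    simp only [hg, hGdef]
    rw [inner_sub_left, inner_smul_left, sqexp y z, abs_le]
    simp only [conj_trivial]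
    constructor <;> nlinarith [b.1, b.2]
  have hgV : ∀ z, g z ≤ V z := by
    intro z
    have := hle z
    simp only [hg, hWdef] at *
    linarith
  have hUg : ∀ p z, (∀ y, U y - V y - inner ℝ p y ≤ U z - V z - inner ℝ p z) →
      ∀ y, U y - g y - inner ℝ p y ≤ U z - V z - inner ℝ p z := by
    intro p z h y
    obtain ⟨q, hq⟩ := hcontact p z h y
    have := heq y _ q hq
    simp only [hg] at *
    linarith
  have hgc : ∀ p z, (∀ y, U y - V y - inner ℝ p y ≤ U z - V z - inner ℝ p z) → g z = V z := by
    intro p z h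
    exact le_antisymm (hgV z) (by linarith [hUg p z h z])
  have hUS : ∀ p z, (∀ y, U y - V y - inner ℝ p y ≤ U z - V z - inner ℝ p z) →
      Sand U (5 * C) z (G z + p) := by
    intro p z h
    obtain ⟨q, hq⟩ := hU z
    have hup : ∀ y, U y ≤ U z + inner ℝ (G z + p) (y - z) + (5 * C) * ‖y - z‖ ^ 2 := by
      intro y
      have b1 := hUg p z h y
      have b2 := abs_le.1 (hgS z y)
      have b3 := hgc p z h
      rw [inner_add_left, inner_sub_right p]
      linarith [b2.2]
    have hq0 : q - (G z + p) = 0 := by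
      apply lin_zero _ (6 * C)
      intro y
      have b1 := hq (z + y)
      have b2 := hup (z + y)
      rw [add_sub_cancel_left] at b1 b2
      rw [inner_sub_left]
      linarith
    have hq1 : q = G z + p := sub_eq_zero.1 hq0
    intro y
    have b1 := hq y
    have b2 := hup y
    have c : 0 ≤ C * ‖y - z‖ ^ 2 := by positivity
    rw [← hq1] at b2 ⊢
    rw [abs_le]
    constructor <;> linarith
  have hGl : ∀ z1 z2, ‖G z1 - G z2‖ ≤ 30 * C * ‖z1 - z2‖ := by
    intro z1 z2
    have := sand_lip (by positivity) (hgS z1) (hgS z2)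
    linarith
  have hGL : LipschitzWith (Real.toNNReal (30 * C)) G := by
    apply LipschitzWith.of_dist_le_mul
    intro x y
    rw [dist_eq_norm, dist_eq_norm, Real.coe_toNNReal _ (by positivity)]
    exact hGl x y
  have hpl : ∀ p1 z1 p2 z2, (∀ y, U y - V y - inner ℝ p1 y ≤ U z1 - V z1 - inner ℝ p1 z1) →
      (∀ y, U y - V y - inner ℝ p2 y ≤ U z2 - V z2 - inner ℝ p2 z2) →
      ‖p1 - p2‖ ≤ 60 * C * ‖z1 - z2‖ := by
    intro p1 z1 p2 z2 h1 h2
    have b1 := sand_lip (by positivity) (hUS p1 z1 h1) (hUS p2 z2 h2)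
    have b2 := hGl z1 z2
    have e1 : p1 - p2 = ((G z1 + p1) - (G z2 + p2)) - (G z1 - G z2) := by abel
    rw [e1]
    refine (norm_sub_le _ _).trans ?_
    linarith
  set μ : Measure E := Measure.hausdorffMeasure (Module.finrank ℝ E) with hμ
  have hae : ∀ᵐ z ∂μ, DifferentiableAt ℝ G z := hGL.ae_differentiableAt
  set N : Set E := {z | ¬ DifferentiableAt ℝ G z} with hN
  have hN0 : μ N = 0 := hae
  set A : Set E := {z | ∃ p, ∀ y, U y - V y - inner ℝ p y ≤ U z - V z - inner ℝ p z} with hA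
  have hPex : ∀ z, ∃ p, z ∈ A → ∀ y, U y - V y - inner ℝ p y ≤ U z - V z - inner ℝ p z := by
    intro z
    by_cases hz : z ∈ A
    · obtain ⟨p, hp⟩ := hz
      exact ⟨p, fun _ => hp⟩
    · exact ⟨0, fun h => absurd h hz⟩
  choose P hP using hPex
  have hPL : LipschitzOnWith (Real.toNNReal (60 * C)) P (A ∩ N) := by
    apply LipschitzOnWith.of_dist_le_mul
    intro x hx y hy
    rw [dist_eq_norm, dist_eq_norm, Real.coe_toNNReal _ (by positivity)]
    exact hpl _ _ _ _ (hP x hx.1) (hP y hy.1)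
  have him : μ (P '' (A ∩ N)) = 0 := by
    have h1 := hPL.hausdorffMeasure_image_le (d := (Module.finrank ℝ E : ℝ)) (by positivity)
    have h2 : μ (A ∩ N) = 0 := measure_mono_null inter_subset_right hN0
    rw [← hμ, h2, mul_zero] at h1
    exact le_antisymm h1 zero_le
  have hball : 0 < μ (ball 0 r) := measure_ball_pos μ 0 hr
  obtain ⟨p, hpb, hpn⟩ : ∃ p ∈ ball (0 : E) r, p ∉ P '' (A ∩ N) := by
    by_contra hcon
    push Not at hcon
    have := measure_mono_null (μ := μ) (show ball (0 : E) r ⊆ P '' (A ∩ N) from hcon) him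
    exact hball.ne' this
  have hpr : ‖p‖ < r := by simpa using hpb
  obtain ⟨z, hz⟩ := hmax p hpr
  have hzA : z ∈ A := ⟨p, hz⟩
  have hPz : P z = p := by
    have := hpl _ _ _ _ (hP z hzA) hz
    simp only [sub_self, norm_zero, mul_zero] at this
    exact sub_eq_zero.1 (norm_le_zero_iff.1 this)
  have hzN : DifferentiableAt ℝ G z := by
    by_contra hcon
    exact hpn ⟨z, ⟨hzA, hcon⟩, hPz⟩
  refine ⟨p, z, G z, fderiv ℝ G z, hpr, hz, fun η hη => ?_⟩
  obtain ⟨δ, hδ, hT⟩ := taylor2 hgS hzN.hasFDerivAt hη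
  refine ⟨δ, hδ, fun y hy => ?_⟩
  have b := abs_le.1 (hT y hy)
  have b3 := hgc p z hz
  have b1 := hUg p z hz (z + y)
  have b2 := hgV (z + y)
  rw [inner_add_right] at b1
  rw [inner_add_left]
  constructor <;> linarith [b.1, b.2]


lemma sq_identity (κ : ℝ) (hκ : 0 < κ) (z a b p : E) :
    κ * ‖z - a‖ ^ 2 + κ * ‖z - b‖ ^ 2 + inner ℝ p z =
      κ / 2 * ‖a - b‖ ^ 2 + inner ℝ p ((1 / 2 : ℝ) • (a + b)) - ‖p‖ ^ 2 / (8 * κ)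
        + 2 * κ * ‖z - ((1 / 2 : ℝ) • (a + b) - (1 / (4 * κ)) • p)‖ ^ 2 := by
  simp only [← real_inner_self_eq_norm_sq, inner_sub_left, inner_sub_right, inner_add_left,
    inner_add_right, inner_smul_left, inner_smul_right, conj_trivial]
  rw [real_inner_comm a z, real_inner_comm b z, real_inner_comm p z, real_inner_comm b a,
    real_inner_comm p a, real_inner_comm p b]
  field_simp
  ring

theorem doubling [FiniteDimensional ℝ E] [MeasurableSpace E] [BorelSpace E] (u v : E → ℝ)
    (K B : Set E) (hK : IsCompact K) (hu : ContinuousOn u K) (hv : ContinuousOn v K)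
    (hB : ∀ z ∈ K, z ∈ B → u z ≤ v z) (x : E) (hx : x ∈ K) (hxx : v x < u x) (r₀ : ℝ)
    (hr₀ : 0 < r₀) :
    ∃ (a b p q : E) (L : E →L[ℝ] E), a ∈ K ∧ b ∈ K ∧ a ∉ B ∧ b ∉ B ∧ ‖p‖ < r₀ ∧
      ∀ η > 0, ∃ δ > 0,
        (∀ y, a + y ∈ K → ‖y‖ < δ →
          u (a + y) ≤ u a + inner ℝ (q + p) y + 1 / 2 * inner ℝ (L y) y + η * ‖y‖ ^ 2) ∧
        (∀ y, b + y ∈ K → ‖y‖ < δ →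
          v b + inner ℝ q y + 1 / 2 * inner ℝ (L y) y - η * ‖y‖ ^ 2 ≤ v (b + y)) := by
  have hne : K.Nonempty := ⟨x, hx⟩
  set m := u x - v x with hm
  have hm0 : 0 < m := by linarith
  obtain ⟨D, hD⟩ : ∃ D, ∀ a ∈ K, ‖a - x‖ ≤ D := by
    obtain ⟨D, hD⟩ := hK.isBounded.subset_closedBall x
    exact ⟨D, fun a ha => by simpa [dist_eq_norm] using hD ha⟩
  have hD0 : 0 ≤ D := (norm_nonneg _).trans (hD x hx)
  obtain ⟨M1, hM1⟩ := hK.exists_bound_of_continuousOn hu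
  obtain ⟨M2, hM2⟩ := hK.exists_bound_of_continuousOn hv
  set M := M1 + M2 with hM
  have hMab : ∀ a ∈ K, ∀ b ∈ K, u a - v b ≤ M := by
    intro a ha b hb
    have h1 := abs_le.1 (hM1 a ha)
    have h2 := abs_le.1 (hM2 b hb)
    linarith [h1.2, h2.1]
  have hM0 : 0 ≤ M := by linarith [hMab x hx x hx]
  obtain ⟨θ1, hθ1, hθu⟩ := Metric.uniformContinuousOn_iff.1
    (hK.uniformContinuousOn_of_continuous hu) (m / 2) (by linarith)
  obtain ⟨θ2, hθ2, hθv⟩ := Metric.uniformContinuousOn_iff.1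
    (hK.uniformContinuousOn_of_continuous hv) (m / 2) (by linarith)
  set θ := min θ1 θ2 / 2 with hθ
  have hθ0 : 0 < θ := by positivity
  have hθa : 2 * θ ≤ θ1 := by rw [hθ]; linarith [min_le_left θ1 θ2]
  have hθb : 2 * θ ≤ θ2 := by rw [hθ]; linarith [min_le_right θ1 θ2]
  set r := min r₀ (min 1 (m / (2 * (θ + D + 1)))) with hr
  have hr0 : 0 < r := by positivity
  have hrr : r ≤ r₀ := min_le_left _ _
  have hr1 : r ≤ 1 := (min_le_right _ _).trans (min_le_left _ _)
  have hr2 : r * (θ + D) ≤ m / 2 := by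
    have h1 : r ≤ m / (2 * (θ + D + 1)) := (min_le_right _ _).trans (min_le_right _ _)
    rw [le_div_iff₀ (by positivity)] at h1
    nlinarith
  set κ := (M + D + 1) / θ ^ 2 + 1 / θ with hκ
  have hκ0 : 0 < κ := by positivity
  have hκs : ∀ s, θ ≤ s → M + D + 1 + s ≤ κ * s ^ 2 := by
    intro s hs
    have h1 : M + D + 1 ≤ (M + D + 1) / θ ^ 2 * s ^ 2 := by
      rw [div_mul_eq_mul_div, le_div_iff₀ (by positivity)]
      apply mul_le_mul_of_nonneg_left _ (by positivity)
      exact pow_le_pow_left₀ hθ0.le hs 2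
    have h2 : s ≤ 1 / θ * s ^ 2 := by
      rw [div_mul_eq_mul_div, le_div_iff₀ (by positivity)]
      nlinarith
    rw [hκ, add_mul]; linarith
  have hα : ∀ z, ∃ a ∈ K, ∀ a' ∈ K, u a' - κ * ‖z - a'‖ ^ 2 ≤ u a - κ * ‖z - a‖ ^ 2 := by
    intro z
    obtain ⟨a, ha, h⟩ := hK.exists_isMaxOn (f := fun a => u a - κ * ‖z - a‖ ^ 2) hne
      (hu.sub (by fun_prop))
    exact ⟨a, ha, fun a' ha' => h ha'⟩
  have hβ : ∀ z, ∃ b ∈ K, ∀ b' ∈ K, v b + κ * ‖z - b‖ ^ 2 ≤ v b' + κ * ‖z - b'‖ ^ 2 := by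
    intro z
    obtain ⟨a, ha, h⟩ := hK.exists_isMinOn (f := fun a => v a + κ * ‖z - a‖ ^ 2) hne
      (hv.add (by fun_prop))
    exact ⟨a, ha, fun a' ha' => h ha'⟩
  choose α hαK hα using hα
  choose β hβK hβ using hβ
  have sqe : ∀ y z a : E, ‖y - a‖ ^ 2 = ‖z - a‖ ^ 2 + 2 * inner ℝ (z - a) (y - z) + ‖y - z‖ ^ 2 := by
    intro y z a
    have := norm_add_sq_real (z - a) (y - z)
    rwa [show z - a + (y - z) = y - a by abel] at this
  obtain ⟨p, z, q, L, hp, hz, hJ⟩ := jensen (fun z => u (α z) - κ * ‖z - α z‖ ^ 2)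
    (fun z => v (β z) + κ * ‖z - β z‖ ^ 2) κ r hκ0.le hr0
    (by
      intro z
      refine ⟨(-2 * κ) • (z - α z), fun y => ?_⟩
      have h1 := hα y (α z) (hαK z)
      rw [sqe y z (α z)] at h1
      rw [inner_smul_left]
      simp only [conj_trivial]
      linarith)
    (by
      intro z
      refine ⟨(2 * κ) • (z - β z), fun y => ?_⟩
      have h1 := hβ y (β z) (hβK z)
      rw [sqe y z (β z)] at h1
      rw [inner_smul_left]
      simp only [conj_trivial]
      linarith)
    (by
      intro p hp
      obtain ⟨⟨a, b⟩, ⟨ha, hb⟩, hab⟩ := (hK.prod hK).exists_isMaxOn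
        (f := fun c : E × E => u c.1 - v c.2 -
          (κ / 2 * ‖c.1 - c.2‖ ^ 2 + inner ℝ p ((1 / 2 : ℝ) • (c.1 + c.2)))) (hne.prod hne)
        (((hu.comp continuousOn_fst (fun c hc => hc.1)).sub
          (hv.comp continuousOn_snd (fun c hc => hc.2))).sub (by fun_prop))
      set z := ((1 / 2 : ℝ) • (a + b) - (1 / (4 * κ)) • p) with hz
      refine ⟨z, fun y => ?_⟩
      have h1 := hab (show (α y, β y) ∈ K ×ˢ K from ⟨hαK y, hβK y⟩)
      simp only [mem_ofPred_eq] at h1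
      have h2 := sq_identity κ hκ0 y (α y) (β y) p
      have h3 := sq_identity κ hκ0 z a b p
      rw [← hz, sub_self, norm_zero] at h3
      have h4 : 0 ≤ 2 * κ *
        ‖y - ((1 / 2 : ℝ) • (α y + β y) - (1 / (4 * κ)) • p)‖ ^ 2 := by positivity
      have h5 := hα z a ha
      have h6 := hβ z b hb
      linarith)
  have hzx := hz x
  have h1 := hα x x hx
  have h2 := hβ x x hx
  simp only [sub_self, norm_zero] at h1 h2
  have h3 : -(‖p‖ * (‖z - α z‖ + D)) ≤ inner ℝ p z - inner ℝ p x := by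
    rw [← inner_sub_right]
    have g1 := abs_le.1 (abs_real_inner_le_norm p (z - x))
    have g2 : ‖z - x‖ ≤ ‖z - α z‖ + D := by
      calc _ = ‖(z - α z) + (α z - x)‖ := by congr 1; abel
        _ ≤ _ := (norm_add_le _ _).trans (by linarith [hD _ (hαK z)])
    have g3 := mul_le_mul_of_nonneg_left g2 (norm_nonneg p)
    linarith [g1.1]
  have h4 : ‖p‖ * (‖z - α z‖ + D) ≤ r * (‖z - α z‖ + D) :=
    mul_le_mul_of_nonneg_right hp.le (by positivity)
  have h5 : r * (‖z - α z‖ + D) ≤ ‖z - α z‖ + D := by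
    have : 0 ≤ ‖z - α z‖ + D := by positivity
    nlinarith
  have h6 := hMab _ (hαK z) _ (hβK z)
  have hs1 : ‖z - α z‖ < θ := by
    by_contra hc
    have g1 := hκs _ (not_lt.1 hc)
    have g2 : 0 ≤ κ * ‖z - β z‖ ^ 2 := by positivity
    linarith
  have hs2 : ‖z - β z‖ < θ := by
    by_contra hc
    have g1 := hκs _ (not_lt.1 hc)
    have g2 : 0 ≤ κ * ‖z - α z‖ ^ 2 := by positivity
    linarith [not_lt.1 hc]
  have hdist : dist (α z) (β z) < 2 * θ := by
    rw [dist_eq_norm]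
    calc _ = ‖(z - β z) - (z - α z)‖ := by congr 1; abel
      _ ≤ _ := norm_sub_le _ _
      _ < 2 * θ := by linarith
  have hkey : m / 2 ≤ u (α z) - v (β z) := by
    have g2 : 0 ≤ κ * ‖z - α z‖ ^ 2 := by positivity
    have g3 : 0 ≤ κ * ‖z - β z‖ ^ 2 := by positivity
    have g4 : r * (‖z - α z‖ + D) ≤ r * (θ + D) := by gcongr
    linarith
  refine ⟨α z, β z, p, q, L, hαK z, hβK z, ?_, ?_, hp.trans_le hrr, ?_⟩
  · intro hc
    have g1 := hB _ (hαK z) hc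
    have g2 := hθv _ (hαK z) _ (hβK z) (hdist.trans_le hθb)
    rw [Real.dist_eq] at g2
    linarith [(abs_lt.1 g2).2]
  · intro hc
    have g1 := hB _ (hβK z) hc
    have g2 := hθu _ (hαK z) _ (hβK z) (hdist.trans_le hθa)
    rw [Real.dist_eq] at g2
    linarith [(abs_lt.1 g2).2]
  · intro η hη
    obtain ⟨δ, hδ, hT⟩ := hJ η hη
    refine ⟨δ, hδ, fun y hyK hy => ?_, fun y hyK hy => ?_⟩
    · have g1 := (hT y hy).2
      have g2 := hα (z + y) _ hyK
      rw [show z + y - (α z + y) = z - α z by abel] at g2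
      linarith
    · have g1 := (hT y hy).1
      have g2 := hβ (z + y) _ hyK
      rw [show z + y - (β z + y) = z - β z by abel] at g2
      linarith

end abstractJ

section testfun
variable {n : ℕ}

noncomputable def quadF (c : ℝ) (x₀ : Eucl n) (t₀ α : ℝ) (β γ : Eucl n) (e : ℝ)
    (S : Matrix (Fin n) (Fin n) ℝ) : SpaceTime n → ℝ := fun p =>
  c + α * (p.2 - t₀) + inner ℝ β (p.1 - x₀)
    + 1 / 2 * inner ℝ (Matrix.toEuclideanLin S (p.1 - x₀)) (p.1 - x₀)
    + (p.2 - t₀) * inner ℝ γ (p.1 - x₀) + e / 2 * (p.2 - t₀) ^ 2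

lemma quadF_test (c : ℝ) (x₀ : Eucl n) (t₀ α : ℝ) (β γ : Eucl n) (e : ℝ)
    (S : Matrix (Fin n) (Fin n) ℝ) (hS : S.IsSymm) (D : Set (SpaceTime n)) :
    ParabolicTest (quadF c x₀ t₀ α β γ e S) D
      (fun p => α + inner ℝ γ (p.1 - x₀) + e * (p.2 - t₀))
      (fun p => β + Matrix.toEuclideanLin S (p.1 - x₀) + (p.2 - t₀) • γ) (fun _ => S) := by
  have hT : Continuous (Matrix.toEuclideanLin S : Eucl n → Eucl n) :=
    LinearMap.continuous_of_finiteDimensional _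
  have hsym : ∀ x y : Eucl n, inner ℝ (Matrix.toEuclideanLin S x) y
      = inner ℝ x (Matrix.toEuclideanLin S y) := by
    have : S.IsHermitian := by
      rw [Matrix.IsHermitian, Matrix.conjTranspose_eq_transpose_of_trivial]; exact hS
    exact Matrix.isSymmetric_toEuclideanLin_iff.2 this
  have hTp : Continuous fun p : SpaceTime n => Matrix.toEuclideanLin S (p.1 - x₀) :=
    hT.comp (by fun_prop)
  refine ⟨?_, ?_, ?_, continuousOn_const, fun _ _ => hS, ?_, ?_, ?_⟩
  · apply Continuous.continuousOn
    unfold quadF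
    fun_prop
  · apply Continuous.continuousOn; fun_prop
  · apply Continuous.continuousOn; fun_prop
  · intro p _
    apply HasDerivAt.hasDerivWithinAt
    unfold quadF
    have h0 : HasDerivAt (fun s : ℝ => s - t₀) 1 p.2 := (hasDerivAt_id _).sub_const _
    have h := ((((h0.const_mul α).const_add c).add_const (inner ℝ β (p.1 - x₀))).add_const
      (1 / 2 * inner ℝ (Matrix.toEuclideanLin S (p.1 - x₀)) (p.1 - x₀))).add
      (h0.mul_const (inner ℝ γ (p.1 - x₀))) |>.add ((h0.pow 2).const_mul (e / 2))
    refine h.congr_deriv ?_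
    simp; ring
  · intro p _
    rw [hasGradientWithinAt_iff_hasFDerivWithinAt]
    apply HasFDerivAt.hasFDerivWithinAt
    unfold quadF
    have h0 : HasFDerivAt (fun y : Eucl n => y - x₀) (ContinuousLinearMap.id ℝ (Eucl n)) p.1 :=
      (hasFDerivAt_id _).sub_const _
    have h1 : HasFDerivAt (fun y : Eucl n => Matrix.toEuclideanLin S (y - x₀))
        (LinearMap.toContinuousLinearMap (Matrix.toEuclideanLin S)) p.1 := by
      have := HasFDerivAt.comp (g := LinearMap.toContinuousLinearMap (Matrix.toEuclideanLin S)) p.1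
        (LinearMap.toContinuousLinearMap (Matrix.toEuclideanLin S)).hasFDerivAt h0
      rw [ContinuousLinearMap.comp_id] at this
      exact this
    have h2 := h1.inner ℝ h0
    have hb := (hasFDerivAt_const β p.1).inner ℝ h0
    have hg := (hasFDerivAt_const γ p.1).inner ℝ h0
    have h := (((hb.const_add (c + α * (p.2 - t₀))).add (h2.const_mul (1 / 2))).add
      (hg.const_mul (p.2 - t₀))).add_const (e / 2 * (p.2 - t₀) ^ 2)
    refine h.congr_fderiv ?_
    ext y
    have hc : inner ℝ (Matrix.toEuclideanLin S y) (p.1 - x₀)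
        = inner ℝ (Matrix.toEuclideanLin S (p.1 - x₀)) y := by
      rw [hsym, real_inner_comm]
    simp [hc]
    rw [inner_sub_left]
    ring
  · intro p _
    apply HasFDerivAt.hasFDerivWithinAt
    have h0 : HasFDerivAt (fun y : Eucl n => y - x₀) (ContinuousLinearMap.id ℝ (Eucl n)) p.1 :=
      (hasFDerivAt_id _).sub_const _
    have h1 : HasFDerivAt (fun y : Eucl n => Matrix.toEuclideanLin S (y - x₀))
        (LinearMap.toContinuousLinearMap (Matrix.toEuclideanLin S)) p.1 := by
      have := HasFDerivAt.comp (g := LinearMap.toContinuousLinearMap (Matrix.toEuclideanLin S)) p.1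
        (LinearMap.toContinuousLinearMap (Matrix.toEuclideanLin S)).hasFDerivAt h0
      rw [ContinuousLinearMap.comp_id] at this
      exact this
    exact (h1.const_add β).add_const ((p.2 - t₀) • γ)

lemma exists_rho {R T : ℝ} {x₀ : Eucl n} {t₀ δ : ℝ} (hx : ‖x₀‖ < R) (ht0 : 0 < t₀)
    (htT : t₀ < T) (hδ : 0 < δ) : ∃ ρ > 0, cylE x₀ t₀ ρ ⊆ ball 0 R ×ˢ Ioo 0 T ∧
      ∀ p ∈ cylE x₀ t₀ ρ, ‖p.1 - x₀‖ + |p.2 - t₀| < δ := by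
  set ρ := min (min 1 (R - ‖x₀‖)) (min t₀ (δ / 2)) with hρ
  have h0 : 0 < ρ := by
    have : 0 < R - ‖x₀‖ := by linarith
    positivity
  have h1 : ρ ≤ 1 := (min_le_left _ _).trans (min_le_left _ _)
  have h2 : ρ ≤ R - ‖x₀‖ := (min_le_left _ _).trans (min_le_right _ _)
  have h3 : ρ ≤ t₀ := (min_le_right _ _).trans (min_le_left _ _)
  have h4 : ρ ≤ δ / 2 := (min_le_right _ _).trans (min_le_right _ _)
  have h5 : ρ ^ 2 ≤ ρ := by nlinarith
  refine ⟨ρ, h0, ?_, ?_⟩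
  · rintro ⟨x, t⟩ ⟨hx', ht'⟩
    simp only [mem_ball, dist_eq_norm] at hx'
    refine ⟨?_, ?_, ?_⟩
    · simp only [mem_ball, dist_zero_right]
      have := norm_le_norm_add_norm_sub' x x₀
      linarith
    · have := ht'.1; simp only at this ⊢; linarith
    · exact lt_of_le_of_lt ht'.2 htT
  · rintro ⟨x, t⟩ ⟨hx', ht'⟩
    simp only [mem_ball, dist_eq_norm] at hx'
    have a := ht'.1
    have b := ht'.2
    simp only at a b ⊢
    rw [abs_of_nonpos (by linarith)]
    linarith

lemma sub_test {R T : ℝ} {F : Matrix (Fin n) (Fin n) ℝ → ℝ} {u : SpaceTime n → ℝ}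
    (hsub : ViscSub F u (ball 0 R ×ˢ Ioo 0 T)) {x₀ : Eucl n} {t₀ δ : ℝ} (hx : ‖x₀‖ < R)
    (ht0 : 0 < t₀) (htT : t₀ < T) (hδ : 0 < δ) (α : ℝ) (β γ : Eucl n) (e : ℝ)
    (S : Matrix (Fin n) (Fin n) ℝ) (hS : S.IsSymm)
    (h : ∀ x s, ‖x‖ ≤ R → 0 ≤ s → s ≤ t₀ → ‖x - x₀‖ + |s - t₀| < δ →
      u (x, s) ≤ quadF (u (x₀, t₀)) x₀ t₀ α β γ e S (x, s)) : α ≤ F S := by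
  obtain ⟨ρ, hρ, h1, h2⟩ := exists_rho hx ht0 htT hδ
  have h0 : (x₀, t₀) ∈ cylE x₀ t₀ ρ := ⟨mem_ball_self hρ, by simp only; constructor <;> nlinarith⟩
  have := hsub _ _ _ _ (x₀, t₀) ρ hρ (h1 h0) h1
    (quadF_test (u (x₀, t₀)) x₀ t₀ α β γ e S hS (cylE x₀ t₀ ρ))
    ⟨h0, by simp [quadF], fun p hp => h p.1 p.2 (mem_ball_zero_iff.1 (h1 hp).1).le (h1 hp).2.1.le
      hp.2.2 (h2 p hp)⟩
  simpa using this

lemma sup_test {R T : ℝ} {F : Matrix (Fin n) (Fin n) ℝ → ℝ} {u : SpaceTime n → ℝ}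
    (hsub : ViscSup F u (ball 0 R ×ˢ Ioo 0 T)) {x₀ : Eucl n} {t₀ δ : ℝ} (hx : ‖x₀‖ < R)
    (ht0 : 0 < t₀) (htT : t₀ < T) (hδ : 0 < δ) (α : ℝ) (β γ : Eucl n) (e : ℝ)
    (S : Matrix (Fin n) (Fin n) ℝ) (hS : S.IsSymm)
    (h : ∀ x s, ‖x‖ ≤ R → 0 ≤ s → s ≤ t₀ → ‖x - x₀‖ + |s - t₀| < δ →
      quadF (u (x₀, t₀)) x₀ t₀ α β γ e S (x, s) ≤ u (x, s)) : F S ≤ α := by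
  obtain ⟨ρ, hρ, h1, h2⟩ := exists_rho hx ht0 htT hδ
  have h0 : (x₀, t₀) ∈ cylE x₀ t₀ ρ := ⟨mem_ball_self hρ, by simp only; constructor <;> nlinarith⟩
  have := hsub _ _ _ _ (x₀, t₀) ρ hρ (h1 h0) h1
    (quadF_test (u (x₀, t₀)) x₀ t₀ α β γ e S hS (cylE x₀ t₀ ρ))
    ⟨h0, by simp [quadF], fun p hp => h p.1 p.2 (mem_ball_zero_iff.1 (h1 hp).1).le (h1 hp).2.1.le
      hp.2.2 (h2 p hp)⟩
  simpa using this

abbrev ST2 (n : ℕ) : Type := WithLp 2 (Eucl n × ℝ)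

lemma quad_split (L : ST2 n →L[ℝ] ST2 n) : ∃ (S : Matrix (Fin n) (Fin n) ℝ) (γ : Eucl n) (e : ℝ),
    S.IsSymm ∧ ∀ (ξ : Eucl n) (τ : ℝ),
      1 / 2 * inner ℝ (L (WithLp.toLp 2 (ξ, τ))) (WithLp.toLp 2 (ξ, τ)) =
        1 / 2 * inner ℝ (Matrix.toEuclideanLin S ξ) ξ + τ * inner ℝ γ ξ + e / 2 * τ ^ 2 := by
  set ι : Eucl n →L[ℝ] ST2 n := ((WithLp.prodContinuousLinearEquiv 2 ℝ (Eucl n) ℝ).symm :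
    (Eucl n × ℝ) →L[ℝ] ST2 n).comp (ContinuousLinearMap.inl ℝ (Eucl n) ℝ) with hι
  have hι' : ∀ ξ, ι ξ = WithLp.toLp 2 (ξ, 0) := fun ξ => rfl
  set o : ST2 n := WithLp.toLp 2 (0, 1) with ho
  have hy : ∀ ξ (τ : ℝ), (WithLp.toLp 2 (ξ, τ) : ST2 n) = ι ξ + τ • o := by
    intro ξ τ
    rw [hι', ho, ← WithLp.toLp_smul, ← WithLp.toLp_add]
    simp
  set N : Eucl n →L[ℝ] Eucl n := (ContinuousLinearMap.adjoint ι).comp (L.comp ι) with hN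
  set S0 : Eucl n →L[ℝ] Eucl n := (1 / 2 : ℝ) • (N + ContinuousLinearMap.adjoint N) with hS0
  refine ⟨Matrix.toEuclideanLin.symm (S0 : Eucl n →ₗ[ℝ] Eucl n),
    (1 / 2 : ℝ) • ContinuousLinearMap.adjoint ι (ContinuousLinearMap.adjoint L o + L o),
    inner ℝ (L o) o, ?_, ?_⟩
  · have : (Matrix.toEuclideanLin.symm (S0 : Eucl n →ₗ[ℝ] Eucl n)).IsHermitian := by
      rw [← Matrix.isSymmetric_toEuclideanLin_iff, LinearEquiv.apply_symm_apply]
      intro x y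
      simp only [hS0, ContinuousLinearMap.coe_coe, _root_.smul_apply,
        _root_.add_apply, inner_smul_left, inner_smul_right, inner_add_left,
        inner_add_right, ContinuousLinearMap.adjoint_inner_left,
        ContinuousLinearMap.adjoint_inner_right, conj_trivial]
      ring
    rw [Matrix.IsHermitian, Matrix.conjTranspose_eq_transpose_of_trivial] at this
    exact this
  · intro ξ τ
    rw [hy, LinearEquiv.apply_symm_apply]
    simp only [hS0, hN, map_add, map_smul, ContinuousLinearMap.coe_coe,
        _root_.smul_apply,
        _root_.add_apply, inner_smul_left, inner_smul_right, inner_add_left,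
        inner_add_right, ContinuousLinearMap.adjoint_inner_left, ContinuousLinearMap.comp_apply,
        ContinuousLinearMap.adjoint_inner_right, conj_trivial]
    rw [real_inner_comm (L (ι ξ)) (ι ξ), real_inner_comm (L (ι ξ)) o]
    ring

end testfun

/-- **Comparison principle.** Let `F` be uniformly elliptic, `u` a viscosity subsolution and
`v` a viscosity supersolution of `w_t = F(D²w)` in `B_R × (0,T)`, both continuous on the
closed cylinder. If `u ≤ v` on the parabolic boundary `(B̄_R × {0}) ∪ (∂B_R × [0,T])`,
then `u ≤ v` in `B_R × (0,T)`. -/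
theorem comparison_principle {n : ℕ} (hn : 1 ≤ n) (Λ R T : ℝ) (hΛ : 1 ≤ Λ)
    (hR : 0 < R) (hT : 0 < T)
    (F : Matrix (Fin n) (Fin n) ℝ → ℝ) (hF : UniformlyElliptic Λ F)
    (u v : SpaceTime n → ℝ)
    (hu : ContinuousOn u (closedBall 0 R ×ˢ Icc 0 T))
    (hv : ContinuousOn v (closedBall 0 R ×ˢ Icc 0 T))
    (hsub : ViscSub F u (ball 0 R ×ˢ Ioo 0 T))
    (hsup : ViscSup F v (ball 0 R ×ˢ Ioo 0 T))
    (hbdry : ∀ p ∈ (closedBall (0 : Eucl n) R ×ˢ ({0} : Set ℝ)) ∪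
        (sphere (0 : Eucl n) R ×ˢ Icc 0 T), u p ≤ v p) :
    ∀ p ∈ ball (0 : Eucl n) R ×ˢ Ioo 0 T, u p ≤ v p := by
  by_contra hcon
  push Not at hcon
  obtain ⟨⟨xs, ts⟩, ⟨hxs, hts0, htsT⟩, hlt⟩ := hcon
  simp only at hts0 htsT hxs
  set m := u (xs, ts) - v (xs, ts) with hm
  have hm0 : 0 < m := by linarith
  set d := m / (2 * T) with hd
  have hd0 : 0 < d := by positivity
  have hdt : d * ts < m := by
    have : d * T = m / 2 := by rw [hd]; field_simp
    nlinarith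
  set K : Set (ST2 n) := WithLp.ofLp ⁻¹' (closedBall (0 : Eucl n) R ×ˢ Icc 0 ts) with hKdef
  have hK : IsCompact K := by
    have h1 : IsCompact (closedBall (0 : Eucl n) R ×ˢ Icc 0 ts) :=
      (isCompact_closedBall _ _).prod isCompact_Icc
    exact (WithLp.homeomorphProd 2 (Eucl n) ℝ).isClosedEmbedding.isCompact_preimage h1
  have hKm : MapsTo (WithLp.ofLp : ST2 n → Eucl n × ℝ) K (closedBall 0 R ×ˢ Icc 0 T) := by
    intro z hz
    exact ⟨hz.1, hz.2.1, hz.2.2.trans htsT.le⟩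
  have hof : Continuous (WithLp.ofLp : ST2 n → Eucl n × ℝ) := WithLp.prod_continuous_ofLp _ _ _
  set B : Set (ST2 n) := {z | z.snd = 0 ∨ ‖z.fst‖ = R} with hB
  letI : MeasurableSpace (ST2 n) := borel _
  haveI : BorelSpace (ST2 n) := ⟨rfl⟩
  obtain ⟨a, b, p, q, L, ha, hb, haB, hbB, hp, hη⟩ := doubling
    (fun z : ST2 n => u z.ofLp - d * z.ofLp.2) (fun z => v z.ofLp) K B hK
    ((hu.comp hof.continuousOn hKm).sub (by fun_prop)) (hv.comp hof.continuousOn hKm)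
    (by
      intro z hz hzB
      have h1 : u z.ofLp ≤ v z.ofLp := by
        apply hbdry
        rcases hzB with h | h
        · exact Or.inl ⟨hz.1, h⟩
        · exact Or.inr ⟨by simpa using h, (hKm hz).2⟩
      have h2 : 0 ≤ d * z.ofLp.2 := mul_nonneg hd0.le hz.2.1
      linarith)
    (WithLp.toLp 2 (xs, ts)) ⟨ball_subset_closedBall hxs, hts0.le, le_rfl⟩
    (by simp only; linarith) (d / 2) (by positivity)
  obtain ⟨S, γ, e, hS, hsplit⟩ := quad_split L
  have hin : ∀ z ∈ K, z ∉ B → ‖z.fst‖ < R ∧ 0 < z.snd ∧ z.snd < T := by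
    intro z hz hzB
    simp only [hB, mem_ofPred_eq, not_or] at hzB
    have h1 : ‖z.fst‖ ≤ R := by simpa using hz.1
    exact ⟨lt_of_le_of_ne h1 hzB.2, lt_of_le_of_ne hz.2.1 (Ne.symm hzB.1),
      lt_of_le_of_lt hz.2.2 htsT⟩
  obtain ⟨ha1, ha2, ha3⟩ := hin a ha haB
  obtain ⟨hb1, hb2, hb3⟩ := hin b hb hbB
  set η := d / (16 * Λ) with hηdef
  have hη0 : 0 < η := by positivity
  obtain ⟨δ, hδ, hsubq, hsupq⟩ := hη η hη0
  have hnorm : ∀ (ξ : Eucl n) (τ : ℝ), ‖(WithLp.toLp 2 (ξ, τ) : ST2 n)‖ ^ 2 = ‖ξ‖ ^ 2 + τ ^ 2 := by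
    intro ξ τ
    rw [WithLp.prod_norm_sq_eq_of_L2]; simp
  have hnlt : ∀ (ξ : Eucl n) (τ : ℝ), ‖ξ‖ + |τ| < δ → ‖(WithLp.toLp 2 (ξ, τ) : ST2 n)‖ < δ := by
    intro ξ τ h
    refine lt_of_pow_lt_pow_left₀ 2 hδ.le ?_
    rw [hnorm, ← sq_abs τ]
    have := norm_nonneg ξ
    have := abs_nonneg τ
    nlinarith
  have hinner : ∀ (w : ST2 n) (ξ : Eucl n) (τ : ℝ), inner ℝ w (WithLp.toLp 2 (ξ, τ))
      = inner ℝ w.fst ξ + w.snd * τ := by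
    intro w ξ τ
    rw [WithLp.prod_inner_apply]
    simp [mul_comm]
  have hmat : ∀ (c : ℝ) (ξ : Eucl n), inner ℝ (Matrix.toEuclideanLin (S + c • 1) ξ) ξ
      = inner ℝ (Matrix.toEuclideanLin S ξ) ξ + c * ‖ξ‖ ^ 2 := by
    intro c ξ
    have : Matrix.toEuclideanLin (S + c • 1) ξ = Matrix.toEuclideanLin S ξ + c • ξ := by
      rw [map_add, map_smul, LinearMap.add_apply, LinearMap.smul_apply]
      congr 2
      ext i
      simp [Matrix.toLpLin_apply]
    rw [this, inner_add_left, inner_smul_left, real_inner_self_eq_norm_sq]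
    simp
  have hsymm : ∀ c : ℝ, (S + c • (1 : Matrix (Fin n) (Fin n) ℝ)).IsSymm := by
    intro c
    exact hS.add (Matrix.isSymm_one.smul c)
  have hadd : ∀ (z : ST2 n) x s, z + WithLp.toLp 2 (x - z.fst, s - z.snd) = WithLp.toLp 2 (x, s) := by
    intro z x s
    apply WithLp.ofLp_injective
    ext <;> simp
  have key1 : d + q.snd + p.snd ≤ F (S + (2 * η) • 1) := by
    apply sub_test hsub ha1 ha2 ha3 hδ _ (q.fst + p.fst) γ (e + 2 * η) _ (hsymm _)
    intro x s hx hs hsa hxs'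
    have h := hsubq (WithLp.toLp 2 (x - a.fst, s - a.snd))
      (by rw [hadd]; exact ⟨by simpa using hx, hs, hsa.trans ha.2.2⟩) (hnlt _ _ hxs')
    rw [hadd, hsplit, hnorm, hinner] at h
    simp only [quadF, hmat]
    simp only [WithLp.add_fst, WithLp.add_snd] at h
    have e1 : u (a.fst, a.snd) = u a.ofLp := rfl
    have e2 : a.ofLp.2 = a.snd := rfl
    rw [e1]
    rw [e2] at h
    linarith
  have key2 : F (S + (-(2 * η)) • 1) ≤ q.snd := by
    apply sup_test hsup hb1 hb2 hb3 hδ _ q.fst γ (e - 2 * η) _ (hsymm _)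
    intro x s hx hs hsa hxs'
    have h := hsupq (WithLp.toLp 2 (x - b.fst, s - b.snd))
      (by rw [hadd]; exact ⟨by simpa using hx, hs, hsa.trans hb.2.2⟩) (hnlt _ _ hxs')
    rw [hadd, hsplit, hnorm, hinner] at h
    simp only [quadF, hmat]
    have e1 : v (b.fst, b.snd) = v b.ofLp := rfl
    rw [e1]
    linarith
  have key3 := (hF (S + (-(2 * η)) • 1) ((4 * η) • 1) (hsymm _) (Matrix.isSymm_one.smul _)
    (Matrix.PosSemidef.one.smul (by positivity))).2
  have e3 : S + (-(2 * η)) • 1 + (4 * η) • 1 = S + (2 * η) • (1 : Matrix (Fin n) (Fin n) ℝ) := by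
    rw [add_assoc, ← add_smul]; congr 2; ring
  rw [e3] at key3
  have hop : matOpNorm ((4 * η) • (1 : Matrix (Fin n) (Fin n) ℝ)) ≤ 4 * η := by
    unfold matOpNorm
    apply ContinuousLinearMap.opNorm_le_bound _ (by positivity)
    intro ξ
    have : Matrix.toEuclideanLin ((4 * η) • (1 : Matrix (Fin n) (Fin n) ℝ)) ξ = (4 * η) • ξ := by
      rw [map_smul, LinearMap.smul_apply]
      congr 1
      ext i
      simp [Matrix.toLpLin_apply]
    rw [LinearMap.coe_toContinuousLinearMap', this, norm_smul, Real.norm_of_nonneg (by positivity)]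
  have hop2 : Λ * matOpNorm ((4 * η) • (1 : Matrix (Fin n) (Fin n) ℝ)) ≤ d / 4 := by
    calc _ ≤ Λ * (4 * η) := mul_le_mul_of_nonneg_left hop (by linarith)
      _ = d / 4 := by rw [hηdef]; field_simp; ring
  have hps : |p.snd| < d / 2 := by
    refine lt_of_le_of_lt ?_ hp
    refine abs_le_of_sq_le_sq ?_ (norm_nonneg _)
    rw [WithLp.prod_norm_sq_eq_of_L2]
    simp
  linarith [(abs_lt.1 hps).1]
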